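/- Let Y be a real m×n matrix, Ω a set of index pairs, C > 0, λ > 0, and Θ an m×m real positive definite matrix. Suppose the pair (Z̄, S̄), with Z̄ supported on Ω and S̄ entrywise nonnegative, maximizes the dual objective D(Z,S) = ⟨Z, Y_Ω⟩ − ‖Z‖²/(4C) − (λ/2) tr((Z+S)ᵀ Θ (Z+S)) over all such pairs. Define W̄ = λ • Θ (Z̄ + S̄). Then: (i) W̄ is entrywise nonnegative; (ii) ⟨S̄, W̄⟩ = 0 (complementary slackness); and (iii) W̄ minimizes the primal objective W ↦ C‖W_Ω − Y_Ω‖² + (1/(2λ)) tr(Wᵀ Θ⁻¹ W) over the set of entrywise-nonnegative m×n matrices. -/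

import Mathlib

open Matrix

open scoped Classical in
/-- The restriction `A_Ω` of a matrix to an index set `Ω`: entries outside `Ω` are set to `0`. -/
noncomputable def restrictM {m n : ℕ} (Ω : Set (Fin m × Fin n))
    (A : Matrix (Fin m) (Fin n) ℝ) : Matrix (Fin m) (Fin n) ℝ :=
  Matrix.of fun i j => if (i, j) ∈ Ω then A i j else 0

theorem trace_transpose_mul_nonneg {m n : Type*} [Fintype m] [Fintype n]
    {A B : Matrix m n ℝ} (hA : ∀ i j, 0 ≤ A i j) (hB : ∀ i j, 0 ≤ B i j) :
    0 ≤ (Aᵀ * B).trace := by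
  simp only [Matrix.trace, Matrix.diag, Matrix.mul_apply, Matrix.transpose_apply]
  exact Finset.sum_nonneg fun j _ => Finset.sum_nonneg fun i _ => mul_nonneg (hA i j) (hB i j)

theorem trace_transpose_mul_comm {m n : Type*} [Fintype m] [Fintype n]
    (A B : Matrix m n ℝ) : (Aᵀ * B).trace = (Bᵀ * A).trace := by
  rw [← Matrix.trace_transpose, Matrix.transpose_mul, Matrix.transpose_transpose]

theorem trace_quadratic_add_smul {m n : Type*} [Fintype m] [Fintype n]
    {M : Matrix m m ℝ} (hM : Mᵀ = M) (A B : Matrix m n ℝ) (t : ℝ) :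
    ((A + t • B)ᵀ * M * (A + t • B)).trace =
      (Aᵀ * M * A).trace + 2 * t * (Bᵀ * (M * A)).trace + t ^ 2 * (Bᵀ * M * B).trace := by
  have h : (Aᵀ * M * B).trace = (Bᵀ * (M * A)).trace := by
    rw [← Matrix.trace_transpose]
    simp [Matrix.transpose_mul, hM]
  simp only [Matrix.transpose_add, Matrix.transpose_smul, Matrix.add_mul, Matrix.mul_add,
    Matrix.smul_mul, Matrix.mul_smul, Matrix.trace_add, Matrix.trace_smul, smul_eq_mul, h,
    Matrix.mul_assoc Bᵀ M A]
  ring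

theorem trace_sq_add_smul {m n : Type*} [Fintype m] [Fintype n]
    (A B : Matrix m n ℝ) (t : ℝ) :
    ((A + t • B)ᵀ * (A + t • B)).trace =
      (Aᵀ * A).trace + 2 * t * (Bᵀ * A).trace + t ^ 2 * (Bᵀ * B).trace := by
  classical
  simpa using trace_quadratic_add_smul (M := 1) Matrix.transpose_one A B t

theorem Matrix.PosSemidef.trace_transpose_mul_mul_nonneg {m n : Type*} [Fintype m] [Fintype n]
    {M : Matrix m m ℝ} (hM : M.PosSemidef) (A : Matrix m n ℝ) :
    0 ≤ (Aᵀ * M * A).trace := by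
  simpa using (hM.conjTranspose_mul_mul_same A).trace_nonneg

/-- A quadratic polynomial without constant term that is nonpositive on `(0, 1]` has nonpositive
linear coefficient. -/
theorem nonpos_of_forall_mul_sub_sq_nonpos {a b : ℝ}
    (h : ∀ t : ℝ, 0 < t → t ≤ 1 → t * a - t ^ 2 * b ≤ 0) : a ≤ 0 := by
  by_contra! ha
  have hd : 0 < a + |b| := by positivity
  obtain ⟨t, ht, ht1, hta⟩ : ∃ t : ℝ, 0 < t ∧ t ≤ 1 ∧ t * b < a := by
    refine ⟨a / (a + |b|), by positivity, ?_, ?_⟩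
    · rw [div_le_one hd]
      linarith [abs_nonneg b]
    · rw [div_mul_eq_mul_div, div_lt_iff₀ hd]
      nlinarith [le_abs_self b]
  nlinarith [h t ht ht1]

section restrictM

variable {m n : ℕ} (Ω : Set (Fin m × Fin n)) (A B : Matrix (Fin m) (Fin n) ℝ)

theorem restrictM_add : restrictM Ω (A + B) = restrictM Ω A + restrictM Ω B := by
  ext i j
  by_cases h : (i, j) ∈ Ω <;> simp [restrictM, h]

theorem restrictM_smul (t : ℝ) : restrictM Ω (t • A) = t • restrictM Ω A := by
  ext i j
  by_cases h : (i, j) ∈ Ω <;> simp [restrictM, h]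

theorem restrictM_restrictM : restrictM Ω (restrictM Ω A) = restrictM Ω A := by
  ext i j
  by_cases h : (i, j) ∈ Ω <;> simp [restrictM, h]

theorem trace_restrictM_transpose_mul :
    ((restrictM Ω A)ᵀ * B).trace = (Aᵀ * restrictM Ω B).trace := by
  simp only [Matrix.trace, Matrix.diag, Matrix.mul_apply, Matrix.transpose_apply]
  refine Finset.sum_congr rfl fun j _ => Finset.sum_congr rfl fun i _ => ?_
  by_cases h : (i, j) ∈ Ω <;> simp [restrictM, h]

end restrictM

/-- First-order optimality condition for the dual objective along a feasible direction
`(H, K)`. -/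
theorem dual_directional_nonpos {m n : ℕ} {Y : Matrix (Fin m) (Fin n) ℝ}
    {Ω : Set (Fin m × Fin n)} {C l : ℝ} {Θ : Matrix (Fin m) (Fin m) ℝ} (hΘ : Θᵀ = Θ)
    {Zb Sb : Matrix (Fin m) (Fin n) ℝ}
    (hZb : restrictM Ω Zb = Zb) (hSb : ∀ i j, 0 ≤ Sb i j)
    (hmax : ∀ Z S : Matrix (Fin m) (Fin n) ℝ, restrictM Ω Z = Z → (∀ i j, 0 ≤ S i j) →
      (Zᵀ * restrictM Ω Y).trace - (Zᵀ * Z).trace / (4 * C)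
          - (l / 2) * ((Z + S)ᵀ * Θ * (Z + S)).trace ≤
        (Zbᵀ * restrictM Ω Y).trace - (Zbᵀ * Zb).trace / (4 * C)
          - (l / 2) * ((Zb + Sb)ᵀ * Θ * (Zb + Sb)).trace)
    {H K : Matrix (Fin m) (Fin n) ℝ} (hH : restrictM Ω H = H)
    (hK : ∀ i j, 0 ≤ Sb i j + K i j) :
    (Hᵀ * restrictM Ω Y).trace - (Hᵀ * Zb).trace / (2 * C)
      - ((H + K)ᵀ * (l • (Θ * (Zb + Sb)))).trace ≤ 0 := by
  refine nonpos_of_forall_mul_sub_sq_nonpos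
    (b := (Hᵀ * H).trace / (4 * C) + l / 2 * ((H + K)ᵀ * Θ * (H + K)).trace) fun t ht ht1 => ?_
  have h := hmax (Zb + t • H) (Sb + t • K)
    (by rw [restrictM_add, restrictM_smul, hZb, hH]) (fun i j => by
      have := mul_nonneg (sub_nonneg.2 ht1) (hSb i j)
      have := mul_nonneg ht.le (hK i j)
      simp only [Matrix.add_apply, Matrix.smul_apply, smul_eq_mul]
      linarith)
  have e : Zb + t • H + (Sb + t • K) = (Zb + Sb) + t • (H + K) := by
    rw [smul_add]
    abel
  rw [e, trace_quadratic_add_smul hΘ, trace_sq_add_smul, Matrix.transpose_add,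
    Matrix.transpose_smul, Matrix.add_mul, Matrix.trace_add, Matrix.smul_mul,
    Matrix.trace_smul, smul_eq_mul] at h
  rw [Matrix.mul_smul, Matrix.trace_smul, smul_eq_mul]
  rw [← sub_nonpos] at h
  refine le_of_eq_of_le ?_ h
  ring

/-- if `(Z̄, S̄)` maximizes the dual objective over pairs with `Z̄`
supported on `Ω` and `S̄` entrywise nonnegative, then `W̄ = λ • Θ (Z̄ + S̄)` is
(i) entrywise nonnegative, (ii) satisfies complementary slackness `⟨S̄, W̄⟩ = 0`, and
(iii) minimizes the primal objective over entrywise-nonnegative matrices. -/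
theorem primal_recovery_from_dual {m n : ℕ} (Y : Matrix (Fin m) (Fin n) ℝ)
    (Ω : Set (Fin m × Fin n)) (C : ℝ) (hC : 0 < C) (l : ℝ) (hl : 0 < l)
    (Θ : Matrix (Fin m) (Fin m) ℝ) (hΘ : Θ.PosDef)
    (Zb Sb : Matrix (Fin m) (Fin n) ℝ)
    (hZb : restrictM Ω Zb = Zb) (hSb : ∀ i j, 0 ≤ Sb i j)
    (hmax : ∀ Z S : Matrix (Fin m) (Fin n) ℝ, restrictM Ω Z = Z → (∀ i j, 0 ≤ S i j) →
      (Zᵀ * restrictM Ω Y).trace - (Zᵀ * Z).trace / (4 * C)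
          - (l / 2) * ((Z + S)ᵀ * Θ * (Z + S)).trace ≤
        (Zbᵀ * restrictM Ω Y).trace - (Zbᵀ * Zb).trace / (4 * C)
          - (l / 2) * ((Zb + Sb)ᵀ * Θ * (Zb + Sb)).trace) :
    (∀ i j, 0 ≤ (l • (Θ * (Zb + Sb))) i j) ∧
      (Sbᵀ * (l • (Θ * (Zb + Sb)))).trace = 0 ∧
      ∀ W : Matrix (Fin m) (Fin n) ℝ, (∀ i j, 0 ≤ W i j) →
        C * ((restrictM Ω (l • (Θ * (Zb + Sb))) - restrictM Ω Y)ᵀ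
              * (restrictM Ω (l • (Θ * (Zb + Sb))) - restrictM Ω Y)).trace
            + (1 / (2 * l)) * ((l • (Θ * (Zb + Sb)))ᵀ * Θ⁻¹ * (l • (Θ * (Zb + Sb)))).trace ≤
          C * ((restrictM Ω W - restrictM Ω Y)ᵀ * (restrictM Ω W - restrictM Ω Y)).trace
            + (1 / (2 * l)) * (Wᵀ * Θ⁻¹ * W).trace := by
  have hsymm : Θᵀ = Θ := by simpa using hΘ.isHermitian.eq
  have hdir {H K : Matrix (Fin m) (Fin n) ℝ} (hH : restrictM Ω H = H)
      (hK : ∀ i j, 0 ≤ Sb i j + K i j) :=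
    dual_directional_nonpos hsymm hZb hSb hmax hH hK
  have h0 : restrictM Ω (0 : Matrix (Fin m) (Fin n) ℝ) = 0 := by
    ext i j
    simp [restrictM]
  have hinv : Θ⁻¹ * (l • (Θ * (Zb + Sb))) = l • (Zb + Sb) := by
    rw [Matrix.mul_smul, Matrix.nonsing_inv_mul_cancel_left _ _
      ((Matrix.isUnit_iff_isUnit_det _).1 hΘ.isUnit)]
  generalize l • (Θ * (Zb + Sb)) = Wb at hdir hinv ⊢
  have hW : ∀ i j, 0 ≤ Wb i j := fun i j => by
    have h := hdir (K := Matrix.single i j 1) h0 fun a b => by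
      have := hSb a b
      rw [Matrix.single_apply]
      split_ifs <;> linarith
    simpa [Matrix.transpose_single, Matrix.trace_single_mul] using h
  have hS : (Sbᵀ * Wb).trace = 0 := by
    refine le_antisymm ?_ (trace_transpose_mul_nonneg hSb hW)
    simpa using hdir (K := -Sb) h0 fun a b => by simp
  refine ⟨hW, hS, fun W hWnn => ?_⟩
  set D := W - Wb with hD
  have hstat : ((restrictM Ω D)ᵀ * restrictM Ω Y).trace - ((restrictM Ω D)ᵀ * Zb).trace / (2 * C)
      - ((restrictM Ω D)ᵀ * Wb).trace = 0 := by
    have h1 := hdir (K := 0) (restrictM_restrictM Ω D) (by simpa using hSb)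
    have h2 := hdir (H := (-1 : ℝ) • restrictM Ω D) (K := 0)
      (by rw [restrictM_smul, restrictM_restrictM]) (by simpa using hSb)
    simp only [add_zero, Matrix.transpose_smul, Matrix.smul_mul, Matrix.trace_smul,
      smul_eq_mul] at h1 h2
    refine le_antisymm h1 ?_
    linear_combination h2
  have hinvsymm : (Θ⁻¹)ᵀ = Θ⁻¹ := by rw [Matrix.transpose_nonsing_inv, hsymm]
  have hWD : W = Wb + (1 : ℝ) • D := by simp [hD]
  have hWY : restrictM Ω W - restrictM Ω Y
      = (restrictM Ω Wb - restrictM Ω Y) + (1 : ℝ) • restrictM Ω D := by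
    rw [← restrictM_smul, ← add_sub_right_comm, ← restrictM_add, ← hWD]
  have hDW : ((restrictM Ω D)ᵀ * restrictM Ω Wb).trace = ((restrictM Ω D)ᵀ * Wb).trace := by
    rw [← trace_restrictM_transpose_mul, restrictM_restrictM]
  have hDZ : ((restrictM Ω D)ᵀ * Zb).trace = (Dᵀ * Zb).trace := by
    rw [trace_restrictM_transpose_mul, hZb]
  have hDS : 0 ≤ (Dᵀ * Sb).trace := by
    rw [trace_transpose_mul_comm, hD, Matrix.mul_sub, Matrix.trace_sub, hS, sub_zero]
    exact trace_transpose_mul_nonneg hSb hWnn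
  have hquad := hΘ.inv.posSemidef.trace_transpose_mul_mul_nonneg D
  have hsq : 0 ≤ ((restrictM Ω D)ᵀ * restrictM Ω D).trace := by
    simpa using (Matrix.PosSemidef.one (R := ℝ)).trace_transpose_mul_mul_nonneg (restrictM Ω D)
  rw [hWY, trace_sq_add_smul, hWD, trace_quadratic_add_smul hinvsymm, hinv, Matrix.mul_sub (restrictM Ω D)ᵀ, Matrix.trace_sub, hDW,
    Matrix.mul_smul, Matrix.trace_smul, Matrix.mul_add Dᵀ, Matrix.trace_add, smul_eq_mul]
  rw [hDZ] at hstat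
  have hlin : ((restrictM Ω D)ᵀ * Wb).trace - ((restrictM Ω D)ᵀ * restrictM Ω Y).trace
      = -((Dᵀ * Zb).trace / (2 * C)) := by linarith
  have key : 0 ≤ (Dᵀ * Sb).trace + C * ((restrictM Ω D)ᵀ * restrictM Ω D).trace
      + 1 / (2 * l) * (Dᵀ * Θ⁻¹ * D).trace := by positivity
  rw [hlin, ← sub_nonneg]
  refine key.trans_eq ?_
  field_simp
  ring
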